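/- Let d be a positive integer, let λ and μ be partitions of d, let k ≥ 0 be an integer, and let σ ∈ S_d be any fixed permutation of cycle type λ. Then the number of strictly monotone sequences (τ_1, …, τ_k) of transpositions in S_d such that the product σ τ_1 τ_2 ⋯ τ_k has cycle type μ equals z(λ) · H^<_k(λ; μ). In particular, this number does not depend on the choice of σ within its conjugacy class. -/

import Mathlib

open Equiv

namespace FSM

/-- The number of cycles of a permutation (counting fixed points), i.e. the number of
orbits, realised as the cardinality of the quotient of the underlying set by the
`SameCycle` relation. -/
noncomputable def cycleCount {α : Type*} (σ : Perm α) : ℕ :=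
  Nat.card (Quot σ.SameCycle)

/-- The size of the cycle (orbit) of `σ` containing `x`, counting fixed points as
cycles of length `1`. -/
noncomputable def orbitSize {α : Type*} (σ : Perm α) (x : α) : ℕ :=
  Nat.card {y : α // σ.SameCycle x y}

/-- The cycle type of a permutation including parts equal to `1` for the fixed points. -/
noncomputable def fullCycleType {α : Type*} [Fintype α] [DecidableEq α] (σ : Perm α) :
    Multiset ℕ :=
  σ.cycleType + Multiset.replicate (Fintype.card α - σ.support.card) 1

/-- A list of permutations is a strictly monotone sequence of transpositions if each
entry is a transposition `(aᵢ bᵢ)` with `aᵢ < bᵢ` and the sequence `b₁, b₂, …` is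
strictly increasing. -/
def IsStrictlyMonotone {d : ℕ} (l : List (Perm (Fin d))) : Prop :=
  ∃ ab : List (Fin d × Fin d),
    l = ab.map (fun p => Equiv.swap p.1 p.2) ∧
    (∀ p ∈ ab, p.1 < p.2) ∧
    List.Chain' (· < ·) (ab.map Prod.snd)

/-- A list of permutations is a weakly monotone sequence of transpositions if each
entry is a transposition `(aᵢ bᵢ)` with `aᵢ < bᵢ` and the sequence `b₁, b₂, …` is
weakly increasing. -/
def IsWeaklyMonotone {d : ℕ} (l : List (Perm (Fin d))) : Prop :=
  ∃ ab : List (Fin d × Fin d),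
    l = ab.map (fun p => Equiv.swap p.1 p.2) ∧
    (∀ p ∈ ab, p.1 < p.2) ∧
    List.Chain' (· ≤ ·) (ab.map Prod.snd)

/-- The strictly monotone Hurwitz number `H^<_k(λ; μ)`: `1/d!` times the number of
tuples `(ρ_λ, τ₁, …, τ_k, ρ_μ)` with `ρ_λ` of cycle type `λ`, `ρ_μ` of cycle type `μ`,
`τ₁, …, τ_k` a strictly monotone sequence of transpositions and
`ρ_λ τ₁ ⋯ τ_k ρ_μ = id`. -/
noncomputable def Hstrict (d k : ℕ) (lam mu : Nat.Partition d) : ℚ :=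
  (Nat.card {t : Perm (Fin d) × List (Perm (Fin d)) × Perm (Fin d) //
      fullCycleType t.1 = lam.parts ∧ fullCycleType t.2.2 = mu.parts ∧
      t.2.1.length = k ∧ IsStrictlyMonotone t.2.1 ∧
      t.1 * t.2.1.prod * t.2.2 = 1} : ℚ) / (d.factorial : ℚ)

/-- The weakly monotone Hurwitz number `H^≤_k(λ; μ)`. -/
noncomputable def Hweak (d k : ℕ) (lam mu : Nat.Partition d) : ℚ :=
  (Nat.card {t : Perm (Fin d) × List (Perm (Fin d)) × Perm (Fin d) //
      fullCycleType t.1 = lam.parts ∧ fullCycleType t.2.2 = mu.parts ∧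
      t.2.1.length = k ∧ IsWeaklyMonotone t.2.1 ∧
      t.1 * t.2.1.prod * t.2.2 = 1} : ℚ) / (d.factorial : ℚ)

/-- `z(λ) = ∏ᵢ λᵢ · ∏ⱼ mⱼ(λ)!`. -/
def zPart {d : ℕ} (lam : Nat.Partition d) : ℕ :=
  lam.parts.prod * ∏ j ∈ lam.parts.toFinset, (lam.parts.count j).factorial

/-- The number of two-colourings of `α` that are invariant under `π`. -/
noncomputable def invariantColoringCount {α : Type*} (π : Perm α) : ℕ :=
  Nat.card {f : α → Bool // ∀ x, f (π x) = f x}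

lemma invariantColoringCount_conj {α : Type*} (π g : Perm α) :
    invariantColoringCount (g * π * g⁻¹) = invariantColoringCount π := by
  refine Nat.card_congr ((Equiv.arrowCongr g.symm (Equiv.refl Bool)).subtypeEquiv fun f => ?_)
  simp only [Equiv.arrowCongr_apply, Function.comp_apply, Equiv.symm_symm, Equiv.refl_apply,
    Perm.mul_apply]
  constructor
  · intro h x
    simpa using h (g x)
  · intro h x
    simpa using h (g⁻¹ x)

lemma invariantColoringCount_one {d : ℕ} :
    invariantColoringCount (1 : Perm (Fin d)) = 2 ^ d := by
  unfold invariantColoringCount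
  simp

lemma invariantColoringCount_mul_swap {α : Type*} [DecidableEq α] {π : Perm α} {a b : α}
    (hb : π b = b) (hab : a ≠ b) :
    invariantColoringCount (π * swap a b) * 2 = invariantColoringCount π := by
  have hne : ∀ x, x ≠ b → π x ≠ b := fun x hx h => hx (π.injective (h.trans hb.symm))
  have key : ∀ f : α → Bool, (∀ x, f ((π * swap a b) x) = f x) → f b = f a := fun f hf => by
    simpa [hb] using hf a
  have e : {f : α → Bool // ∀ x, f ((π * swap a b) x) = f x} × Bool ≃
      {f : α → Bool // ∀ x, f (π x) = f x} :=
    { toFun := fun p => ⟨Function.update p.1.1 b p.2, fun x => by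
        obtain ⟨⟨f, hf⟩, c⟩ := p
        have hk := key f hf
        by_cases hx : x = b
        · subst hx; rw [hb]
        · simp only [Function.update_of_ne hx, Function.update_of_ne (hne x hx)]
          by_cases hxa : x = a
          · subst hxa
            simpa [hk] using hf b
          · simpa [swap_apply_of_ne_of_ne hxa hx] using hf x⟩
      invFun := fun g => (⟨Function.update g.1 b (g.1 a), fun x => by
        obtain ⟨g, hg⟩ := g
        simp only [Perm.mul_apply]
        by_cases hx : x = b
        · subst hx
          simp [Function.update_of_ne (hne a hab), hg]
        · by_cases hxa : x = a
          · subst hxa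
            simp [hb, hab]
          · simp [swap_apply_of_ne_of_ne hxa hx, Function.update_of_ne hx,
              Function.update_of_ne (hne x hx), hg]⟩, g.1 b)
      left_inv := fun p => by
        obtain ⟨⟨f, hf⟩, c⟩ := p
        simp [hab, ← key f hf]
      right_inv := fun g => by
        simp }
  unfold invariantColoringCount
  rw [← Nat.card_congr e, Nat.card_prod]
  simp

/-- The product of the transpositions `swap a b` over the pairs `(a, b)` in a list. -/
def swapProd {d : ℕ} (ab : List (Fin d × Fin d)) : Perm (Fin d) :=
  (ab.map fun p => swap p.1 p.2).prod

/-- Lists of pairs `(a, b)` with `a < b` whose second entries strictly increase. -/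
def IsMonotonePairs {d : ℕ} (ab : List (Fin d × Fin d)) : Prop :=
  (∀ p ∈ ab, p.1 < p.2) ∧ ab.Pairwise fun p q => p.2 < q.2

lemma isStrictlyMonotone_iff {d : ℕ} {l : List (Perm (Fin d))} :
    IsStrictlyMonotone l ↔ ∃ ab : List (Fin d × Fin d),
      l = ab.map (fun p => swap p.1 p.2) ∧ IsMonotonePairs ab := by
  unfold IsStrictlyMonotone IsMonotonePairs
  refine exists_congr fun ab => ?_
  have : List.IsChain (· < ·) (ab.map Prod.snd) ↔ ab.Pairwise fun p q => p.2 < q.2 := by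
    rw [List.isChain_iff_pairwise, List.pairwise_map]
  exact and_congr_right fun _ => and_congr_right fun _ => this

lemma swapProd_concat {d : ℕ} (ab : List (Fin d × Fin d)) (p : Fin d × Fin d) :
    swapProd (ab ++ [p]) = swapProd ab * swap p.1 p.2 := by
  simp [swapProd]

lemma isMonotonePairs_concat {d : ℕ} {ab : List (Fin d × Fin d)} {p : Fin d × Fin d} :
    IsMonotonePairs (ab ++ [p]) ↔
      IsMonotonePairs ab ∧ p.1 < p.2 ∧ ∀ q ∈ ab, q.2 < p.2 := by
  simp only [IsMonotonePairs, List.pairwise_append, List.mem_append, List.mem_singleton]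
  grind

lemma swapProd_apply_of_lt {d : ℕ} {ab : List (Fin d × Fin d)} {x : Fin d}
    (h : ∀ p ∈ ab, p.1 < p.2) (hx : ∀ p ∈ ab, p.2 < x) : swapProd ab x = x := by
  induction ab with
  | nil => rfl
  | cons p ab ih =>
    have h₁ := h p (by simp)
    have h₂ := hx p (by simp)
    have : swapProd (p :: ab) x = swap p.1 p.2 (swapProd ab x) := by simp [swapProd]
    rw [this, ih (fun q hq => h q (by simp [hq])) (fun q hq => hx q (by simp [hq])),
      swap_apply_of_ne_of_ne (h₁.trans h₂).ne' h₂.ne']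

lemma invariantColoringCount_swapProd {d : ℕ} {ab : List (Fin d × Fin d)}
    (h : IsMonotonePairs ab) :
    invariantColoringCount (swapProd ab) * 2 ^ ab.length = 2 ^ d := by
  induction ab using List.reverseRecOn with
  | nil => simpa [swapProd] using invariantColoringCount_one
  | append_singleton ab p ih =>
    obtain ⟨h₁, h₂, h₃⟩ := isMonotonePairs_concat.1 h
    rw [swapProd_concat, ← ih h₁,
      ← invariantColoringCount_mul_swap (swapProd_apply_of_lt h₁.1 h₃) h₂.ne]
    simp [pow_succ]
    ring

lemma swapProd_concat_apply_fst {d : ℕ} {ab : List (Fin d × Fin d)} {p : Fin d × Fin d}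
    (h : IsMonotonePairs (ab ++ [p])) : swapProd (ab ++ [p]) p.1 = p.2 := by
  obtain ⟨h₁, -, h₃⟩ := isMonotonePairs_concat.1 h
  simp [swapProd_concat, swapProd_apply_of_lt h₁.1 h₃]

/-- The product of a monotone list determines its last second entry. -/
lemma snd_le_of_swapProd_eq {d : ℕ} {ab ab' : List (Fin d × Fin d)} {p p' : Fin d × Fin d}
    (h : IsMonotonePairs (ab ++ [p])) (h' : IsMonotonePairs (ab' ++ [p']))
    (heq : swapProd (ab ++ [p]) = swapProd (ab' ++ [p'])) : p'.2 ≤ p.2 := by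
  by_contra! hlt
  have h₃ := (isMonotonePairs_concat.1 h).2.2
  have hfix : swapProd (ab ++ [p]) p'.2 = p'.2 :=
    swapProd_apply_of_lt h.1 (by simp only [List.mem_append, List.mem_singleton]; grind)
  rw [heq, ← swapProd_concat_apply_fst h'] at hfix
  have := (swapProd (ab' ++ [p'])).injective hfix
  rw [swapProd_concat_apply_fst h'] at this
  exact (isMonotonePairs_concat.1 h').2.1.ne' this

lemma swapProd_concat_ne_one {d : ℕ} {ab : List (Fin d × Fin d)} {p : Fin d × Fin d}
    (h : IsMonotonePairs (ab ++ [p])) : swapProd (ab ++ [p]) ≠ 1 := fun h1 => by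
  have := swapProd_concat_apply_fst h
  rw [h1, Perm.one_apply] at this
  exact (isMonotonePairs_concat.1 h).2.1.ne this

lemma swapProd_injOn {d : ℕ} :
    Set.InjOn (swapProd (d := d)) {ab | IsMonotonePairs ab} := by
  intro ab h ab' h' heq
  simp only [Set.mem_ofPred_eq] at h h'
  induction ab using List.reverseRecOn generalizing ab' with
  | nil =>
    rcases List.eq_nil_or_concat' ab' with rfl | ⟨ab', p', rfl⟩
    · rfl
    · exact absurd heq.symm (swapProd_concat_ne_one h')
  | append_singleton ab p ih =>
    rcases List.eq_nil_or_concat' ab' with rfl | ⟨ab', p', rfl⟩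
    · exact absurd heq (swapProd_concat_ne_one h)
    · have h2 : p.2 = p'.2 :=
        le_antisymm (snd_le_of_swapProd_eq h' h heq.symm) (snd_le_of_swapProd_eq h h' heq)
      have h1 : p.1 = p'.1 := by
        apply (swapProd (ab ++ [p])).injective
        rw [swapProd_concat_apply_fst h, heq, swapProd_concat_apply_fst h', h2]
      obtain rfl : p = p' := Prod.ext h1 h2
      rw [swapProd_concat, swapProd_concat] at heq
      rw [ih (isMonotonePairs_concat.1 h).1 (isMonotonePairs_concat.1 h').1
        (mul_right_cancel heq)]

lemma exists_swapProd_eq_of_fixed {d : ℕ} (m : ℕ) (π : Perm (Fin d))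
    (hπ : ∀ x : Fin d, m ≤ x → π x = x) :
    ∃ ab, IsMonotonePairs ab ∧ (∀ p ∈ ab, (p.2 : ℕ) < m) ∧ swapProd ab = π := by
  induction m generalizing π with
  | zero =>
    refine ⟨[], by simp [IsMonotonePairs], by simp, ?_⟩
    ext x
    simp [swapProd, hπ x]
  | succ m ih =>
    by_cases hm : ∀ x : Fin d, m ≤ x → π x = x
    · obtain ⟨ab, h₁, h₂, h₃⟩ := ih π hm
      exact ⟨ab, h₁, fun p hp => (h₂ p hp).trans (Nat.lt_succ_self m), h₃⟩
    · push Not at hm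
      obtain ⟨b, hmb, hb⟩ := hm
      have hbm : (b : ℕ) = m := by
        by_contra hne
        exact hb (hπ b (by omega))
      have hab : π⁻¹ b < b := by
        by_contra! hle
        rcases hle.eq_or_lt with heq | hlt
        · exact hb (by simpa using congrArg π heq)
        · have := hπ (π⁻¹ b) (by have : (b : ℕ) < (π⁻¹ b : Fin d) := hlt; omega)
          exact hlt.ne (by simpa using this)
      obtain ⟨ab, h₁, h₂, h₃⟩ := ih (π * swap (π⁻¹ b) b) (fun x hx => by
        by_cases hxb : x = b
        · subst hxb; simp
        · have hbx : (b : ℕ) < x := by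
            have : (x : ℕ) ≠ b := fun h => hxb (Fin.ext h)
            omega
          have hxa : x ≠ π⁻¹ b := (hab.trans (Fin.lt_def.2 hbx)).ne'
          rw [Perm.mul_apply, swap_apply_of_ne_of_ne hxa hxb, hπ x (by omega)])
      refine ⟨ab ++ [(π⁻¹ b, b)], isMonotonePairs_concat.2 ⟨h₁, hab, fun q hq => ?_⟩, ?_, ?_⟩
      · have := h₂ q hq
        exact Fin.lt_def.2 (by simpa [hbm] using this)
      · simp only [List.mem_append, List.mem_singleton]
        rintro p (hp | rfl)
        · exact (h₂ p hp).trans (Nat.lt_succ_self m)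
        · simp [hbm]
      · rw [swapProd_concat, h₃, mul_assoc, swap_mul_self, mul_one]

/-- Every permutation is the product of a unique strictly monotone sequence of
transpositions, whose length is determined by the number of invariant colourings. -/
lemma card_isStrictlyMonotone_prod {d k : ℕ} (P : Perm (Fin d) → Prop) :
    Nat.card {l : List (Perm (Fin d)) // l.length = k ∧ IsStrictlyMonotone l ∧ P l.prod} =
      Nat.card {π : Perm (Fin d) // invariantColoringCount π * 2 ^ k = 2 ^ d ∧ P π} := by
  have hlen : ∀ ab : List (Fin d × Fin d), IsMonotonePairs ab →
      (invariantColoringCount (swapProd ab) * 2 ^ k = 2 ^ d ↔ ab.length = k) := by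
    intro ab h
    have h₀ := invariantColoringCount_swapProd h
    refine ⟨fun hk => ?_, fun hk => hk ▸ h₀⟩
    have hpos : 0 < invariantColoringCount (swapProd ab) :=
      Nat.pos_of_ne_zero fun h0 => by
        rw [h0, zero_mul] at hk
        exact (Nat.two_pow_pos d).ne hk
    exact Nat.pow_right_injective le_rfl (Nat.eq_of_mul_eq_mul_left hpos (h₀.trans hk.symm))
  refine Nat.card_congr (Equiv.ofBijective
    (fun l => ⟨l.1.prod, ?_, l.2.2.2⟩) ⟨?_, ?_⟩)
  · obtain ⟨l, hk, hl, -⟩ := l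
    obtain ⟨ab, rfl, hab⟩ := isStrictlyMonotone_iff.1 hl
    exact (hlen ab hab).2 (by simpa using hk)
  · rintro ⟨l, _, hl, _⟩ ⟨l', _, hl', _⟩ heq
    have hprod : l.prod = l'.prod := congrArg Subtype.val heq
    obtain ⟨ab, rfl, hab⟩ := isStrictlyMonotone_iff.1 hl
    obtain ⟨ab', rfl, hab'⟩ := isStrictlyMonotone_iff.1 hl'
    simp only [swapProd_injOn hab hab' hprod]
  · rintro ⟨π, hk, hP⟩
    obtain ⟨ab, hab, -, rfl⟩ := exists_swapProd_eq_of_fixed d π fun x hx =>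
      absurd x.2 (not_lt.2 hx)
    exact ⟨⟨ab.map fun p => swap p.1 p.2, by simpa using (hlen ab hab).1 hk,
      isStrictlyMonotone_iff.2 ⟨ab, rfl, hab⟩, by exact hP⟩, rfl⟩

lemma fullCycleType_conj {d : ℕ} (π g : Perm (Fin d)) :
    fullCycleType (g * π * g⁻¹) = fullCycleType π := by
  simp [fullCycleType]

lemma fullCycleType_inv {d : ℕ} (π : Perm (Fin d)) :
    fullCycleType π⁻¹ = fullCycleType π := by
  simp [fullCycleType]

lemma fullCycleType_eq_iff_isConj {d : ℕ} {π ρ : Perm (Fin d)} :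
    fullCycleType π = fullCycleType ρ ↔ IsConj π ρ := by
  rw [Perm.partition_eq_of_isConj, Nat.Partition.ext_iff]
  rfl

lemma card_isStrictlyMonotone_of_isConj {d k : ℕ} {σ ρ : Perm (Fin d)} (h : IsConj σ ρ)
    (s : Multiset ℕ) :
    Nat.card {l : List (Perm (Fin d)) // l.length = k ∧ IsStrictlyMonotone l ∧
        fullCycleType (ρ * l.prod) = s} =
      Nat.card {l : List (Perm (Fin d)) // l.length = k ∧ IsStrictlyMonotone l ∧
        fullCycleType (σ * l.prod) = s} := by
  obtain ⟨g, rfl⟩ := isConj_iff.1 h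
  rw [card_isStrictlyMonotone_prod (fun π => fullCycleType (g * σ * g⁻¹ * π) = s),
    card_isStrictlyMonotone_prod (fun π => fullCycleType (σ * π) = s)]
  refine (Nat.card_congr ((MulAut.conj g).toEquiv.subtypeEquiv fun π => ?_)).symm
  simp only [MulEquiv.toEquiv_eq_coe, MulEquiv.coe_toEquiv, MulAut.conj_apply,
    invariantColoringCount_conj]
  rw [show g * σ * g⁻¹ * (g * π * g⁻¹) = g * (σ * π) * g⁻¹ by group, fullCycleType_conj]

lemma card_isConj_mul_zPart {d : ℕ} {lam : Nat.Partition d} {σ : Perm (Fin d)}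
    (hσ : fullCycleType σ = lam.parts) :
    Nat.card {ρ : Perm (Fin d) // IsConj σ ρ} * zPart lam = d.factorial := by
  have hz : zPart lam = (d - σ.cycleType.sum).factorial * σ.cycleType.prod *
      ∏ n ∈ σ.cycleType.toFinset, (σ.cycleType.count n).factorial := by
    have h1 : 1 ∉ σ.cycleType := fun h => absurd (Perm.one_lt_of_mem_cycleType h) (lt_irrefl 1)
    have hprod : ∏ j ∈ lam.parts.toFinset, (lam.parts.count j).factorial =
        ∏ j ∈ insert 1 σ.cycleType.toFinset, (lam.parts.count j).factorial := by
      apply Finset.prod_subset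
      · intro j
        simp only [← hσ, fullCycleType, Multiset.mem_toFinset, Multiset.mem_add,
          Multiset.mem_replicate, Finset.mem_insert]
        tauto
      · intro j _ hj
        rw [Multiset.mem_toFinset] at hj
        simp [Multiset.count_eq_zero_of_notMem hj]
    unfold zPart
    rw [hprod, Finset.prod_insert (by simpa using h1), ← hσ, Perm.sum_cycleType]
    have hc : ∀ j ∈ σ.cycleType.toFinset,
        ((fullCycleType σ).count j).factorial = (σ.cycleType.count j).factorial := by
      intro j hj
      have hj1 : 1 ≠ j := fun h => h1 (by simpa [h] using hj)
      simp [fullCycleType, Multiset.count_replicate, hj1]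
    rw [Finset.prod_congr rfl hc]
    simp [fullCycleType, Multiset.count_eq_zero_of_notMem h1]
    ring
  have := Perm.card_isConj_mul_eq σ
  rw [Fintype.card_fin, ← hz] at this
  exact this

lemma card_hurwitz_tuples {d k : ℕ} {lam : Nat.Partition d} (mu : Nat.Partition d)
    {σ : Perm (Fin d)} (hσ : fullCycleType σ = lam.parts) :
    Nat.card {t : Perm (Fin d) × List (Perm (Fin d)) × Perm (Fin d) //
        fullCycleType t.1 = lam.parts ∧ fullCycleType t.2.2 = mu.parts ∧
        t.2.1.length = k ∧ IsStrictlyMonotone t.2.1 ∧ t.1 * t.2.1.prod * t.2.2 = 1} =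
      Nat.card {ρ : Perm (Fin d) // IsConj σ ρ} *
        Nat.card {l : List (Perm (Fin d)) // l.length = k ∧ IsStrictlyMonotone l ∧
          fullCycleType (σ * l.prod) = mu.parts} := by
  rw [← Nat.card_prod]
  have hfib : ∀ ρ : {ρ : Perm (Fin d) // IsConj σ ρ}, Nonempty
      ({l : List (Perm (Fin d)) // l.length = k ∧ IsStrictlyMonotone l ∧
          fullCycleType (ρ.1 * l.prod) = mu.parts} ≃
        {l : List (Perm (Fin d)) // l.length = k ∧ IsStrictlyMonotone l ∧
          fullCycleType (σ * l.prod) = mu.parts}) := by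
    intro ρ
    have hfin : ∀ τ : Perm (Fin d), Finite {l : List (Perm (Fin d)) //
        l.length = k ∧ IsStrictlyMonotone l ∧ fullCycleType (τ * l.prod) = mu.parts} :=
      fun τ => ((List.finite_length_eq (Perm (Fin d)) k).subset fun l hl => hl.1).to_subtype
    have := hfin σ
    have := hfin ρ.1
    exact Finite.card_eq.1 (card_isStrictlyMonotone_of_isConj ρ.2 _)
  refine Nat.card_congr (Equiv.trans ?_ ((Equiv.sigmaCongrRight fun ρ => (hfib ρ).some).trans
    (Equiv.sigmaEquivProd _ _)))
  have hconj : ∀ ρ : Perm (Fin d), fullCycleType ρ = lam.parts ↔ IsConj σ ρ := fun ρ => by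
    rw [← hσ, eq_comm, fullCycleType_eq_iff_isConj]
  exact
    { toFun := fun t => ⟨⟨t.1.1, (hconj _).1 t.2.1⟩, ⟨t.1.2.1, t.2.2.2.1, t.2.2.2.2.1, by
        rw [eq_inv_of_mul_eq_one_left t.2.2.2.2.2, fullCycleType_inv, t.2.2.1]⟩⟩
      invFun := fun s => ⟨(s.1.1, s.2.1, (s.1.1 * s.2.1.prod)⁻¹), (hconj _).2 s.1.2,
        by rw [fullCycleType_inv]; exact s.2.2.2.2, s.2.2.1, s.2.2.2.1, mul_inv_cancel _⟩
      left_inv := fun t => by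
        obtain ⟨⟨ρ, l, τ⟩, h₁, h₂, h₃, h₄, h₅⟩ := t
        simp only [Subtype.mk.injEq, Prod.mk.injEq, true_and]
        exact (eq_inv_of_mul_eq_one_right h₅).symm
      right_inv := fun s => rfl }

end FSM
open FSM in
/-- **Counting strictly monotone sequences with prescribed product cycle type.**
If `σ ∈ S_d` is any fixed permutation of cycle type `λ`, then the number of strictly
monotone sequences `(τ₁, …, τ_k)` of transpositions such that `σ τ₁ τ₂ ⋯ τ_k` has
cycle type `μ` equals `z(λ) · H^<_k(λ; μ)`; in particular it does not depend on the
choice of `σ` in its conjugacy class. -/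
theorem card_strictlyMonotone_fixed_start
    (d k : ℕ) (hd : 0 < d) (lam mu : Nat.Partition d) (σ : Equiv.Perm (Fin d))
    (hσ : fullCycleType σ = lam.parts) :
    (Nat.card {l : List (Equiv.Perm (Fin d)) //
        l.length = k ∧ IsStrictlyMonotone l ∧
        fullCycleType (σ * l.prod) = mu.parts} : ℚ) =
      (zPart lam : ℚ) * Hstrict d k lam mu := by
  have hcard := card_isConj_mul_zPart hσ
  have hfac : (d.factorial : ℚ) ≠ 0 := Nat.cast_ne_zero.2 d.factorial_ne_zero
  rw [Hstrict, card_hurwitz_tuples mu hσ, ← mul_div_assoc, eq_div_iff hfac, ← hcard]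
  push_cast
  ring
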